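/- (Weight dividing) Let A ⊆ R be an additive subgroup with the property that ρ_d(A) ⊆ A for every integer d ≥ 1. Fix g ∈ ℕ. If some element of A has nonzero coefficient of the single-variable monomial x_{g,m,0} for some m ≥ 1, then there exists an element of A whose coefficient of the single-variable monomial x_{g,1,0} is nonzero and whose coefficient of the single-variable monomial x_{g,m',0} is zero for every m' > 1. -/

import Mathlib

open scoped TensorProduct

/-- The index set σ = {(g,m,k) ∈ ℕ³ : m ≥ 1 and (m−1)·k = 0}. -/
abbrev CurveIdx : Type := {p : ℕ × ℕ × ℕ // 1 ≤ p.2.1 ∧ (p.2.1 - 1) * p.2.2 = 0}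

/-- R = MvPolynomial σ ℤ. -/
abbrev Rz : Type := MvPolynomial CurveIdx ℤ

/-- x̄_{g,a,k} : equals the variable x_{g,a,k} if a ≥ 1 (and (a−1)k = 0), and 1 if a = 0. -/
noncomputable def xbar (g a k : ℕ) : Rz :=
  if h : 1 ≤ a ∧ (a - 1) * k = 0 then MvPolynomial.X ⟨(g, a, k), h⟩ else 1

/-- ρ_d : R → R, the unique ring homomorphism with ρ_d(x_{g,m,k}) = x_{g,m/d,k} if d ∣ m and
(k = 0 or d = 1), and ρ_d(x_{g,m,k}) = 0 otherwise. -/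
noncomputable def ρz (d : ℕ) : Rz →ₐ[ℤ] Rz :=
  MvPolynomial.aeval fun v =>
    if d ∣ v.1.2.1 ∧ (v.1.2.2 = 0 ∨ d = 1) then xbar v.1.1 (v.1.2.1 / d) v.1.2.2 else 0

/-- The linear coefficients of `p * X w` come from the constant coefficient of `p`. -/
theorem MvPolynomial.coeff_single_one_mul_X {ι R : Type*} [DecidableEq ι] [CommSemiring R]
    (v w : ι) (p : MvPolynomial ι R) :
    coeff (Finsupp.single v 1) (p * X w) = if w = v then constantCoeff p else 0 := by
  rw [coeff_mul_X', Finsupp.support_single _ one_ne_zero]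
  by_cases h : w = v
  · subst h
    simp [constantCoeff_eq]
  · simp [h]

theorem xbar_of_valid {g a k : ℕ} (h : 1 ≤ a ∧ (a - 1) * k = 0) :
    xbar g a k = MvPolynomial.X ⟨(g, a, k), h⟩ :=
  dif_pos h

theorem ρz_X_of_dvd {d : ℕ} (v : CurveIdx)
    (h : d ∣ v.1.2.1 ∧ (v.1.2.2 = 0 ∨ d = 1)) :
    ∃ hv, ρz d (MvPolynomial.X v) =
      MvPolynomial.X (⟨(v.1.1, v.1.2.1 / d, v.1.2.2), hv⟩ : CurveIdx) := by
  have hv : 1 ≤ v.1.2.1 / d ∧ (v.1.2.1 / d - 1) * v.1.2.2 = 0 := by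
    refine ⟨Nat.div_pos (Nat.le_of_dvd v.2.1 h.1) (Nat.pos_of_dvd_of_pos h.1 v.2.1), ?_⟩
    rcases h.2 with hk | rfl
    · simp [hk]
    · simpa using v.2.2
  exact ⟨hv, by rw [ρz, MvPolynomial.aeval_X, if_pos h, xbar_of_valid hv]⟩

theorem ρz_X_of_not_dvd {d : ℕ} (v : CurveIdx)
    (h : ¬(d ∣ v.1.2.1 ∧ (v.1.2.2 = 0 ∨ d = 1))) :
    ρz d (MvPolynomial.X v) = 0 := by
  rw [ρz, MvPolynomial.aeval_X, if_neg h]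

theorem constantCoeff_ρz (d : ℕ) (p : Rz) :
    MvPolynomial.constantCoeff (ρz d p) = MvPolynomial.constantCoeff p := by
  induction p using MvPolynomial.induction_on with
  | C a => rw [← MvPolynomial.algebraMap_eq, AlgHom.commutes]
  | add p q hp hq => simp only [map_add, hp, hq]
  | mul_X p v _ =>
    by_cases h : d ∣ v.1.2.1 ∧ (v.1.2.2 = 0 ∨ d = 1)
    · obtain ⟨hv, e⟩ := ρz_X_of_dvd v h
      simp only [map_mul, e, MvPolynomial.constantCoeff_X, mul_zero]
    · simp only [map_mul, ρz_X_of_not_dvd v h, map_zero, MvPolynomial.constantCoeff_X, mul_zero]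

/-- The coefficient of `x_{g,n,0}` in `ρ_d p` is the coefficient of `x_{g,dn,0}` in `p`. -/
theorem coeff_single_ρz {d : ℕ} (hd : 1 ≤ d) (g n : ℕ) (hn : 1 ≤ n ∧ (n - 1) * 0 = 0)
    (hdn : 1 ≤ d * n ∧ (d * n - 1) * 0 = 0) (p : Rz) :
    MvPolynomial.coeff (Finsupp.single (⟨(g, n, 0), hn⟩ : CurveIdx) 1) (ρz d p) =
      MvPolynomial.coeff (Finsupp.single (⟨(g, d * n, 0), hdn⟩ : CurveIdx) 1) p := by
  induction p using MvPolynomial.induction_on with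
  | C a =>
    rw [← MvPolynomial.algebraMap_eq, AlgHom.commutes, MvPolynomial.algebraMap_eq,
      MvPolynomial.coeff_C, MvPolynomial.coeff_C, if_neg, if_neg] <;>
    exact (Finsupp.single_ne_zero.mpr one_ne_zero).symm
  | add p q hp hq => simp only [map_add, MvPolynomial.coeff_add, hp, hq]
  | mul_X p v _ =>
    rw [map_mul, MvPolynomial.coeff_single_one_mul_X]
    obtain ⟨⟨g', m, k⟩, hm⟩ := v
    by_cases h : d ∣ m ∧ (k = 0 ∨ d = 1)
    · obtain ⟨hv, e⟩ := ρz_X_of_dvd ⟨(g', m, k), hm⟩ h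
      rw [e, MvPolynomial.coeff_single_one_mul_X, constantCoeff_ρz]
      have hiff : m / d = n ↔ m = d * n := Nat.div_eq_iff_eq_mul_right hd h.1
      simp only [Subtype.mk.injEq, Prod.mk.injEq, hiff]
    · rw [ρz_X_of_not_dvd ⟨(g', m, k), hm⟩ h, mul_zero, MvPolynomial.coeff_zero, if_neg]
      simp only [Subtype.mk.injEq, Prod.mk.injEq]
      rintro ⟨-, rfl, rfl⟩
      exact h ⟨dvd_mul_right d n, Or.inl rfl⟩

/-- Only finitely many `x_{g,n,0}` occur linearly in `p`. -/
theorem finite_setOf_coeff_single_ne_zero (g : ℕ) (p : Rz) :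
    {n : ℕ | ∃ hn : 1 ≤ n ∧ (n - 1) * 0 = 0,
      MvPolynomial.coeff (Finsupp.single (⟨(g, n, 0), hn⟩ : CurveIdx) 1) p ≠ 0}.Finite := by
  refine (p.vars.finite_toSet.image fun v => v.1.2.1).subset ?_
  rintro n ⟨hn, h⟩
  refine ⟨⟨(g, n, 0), hn⟩, ?_, rfl⟩
  exact (MvPolynomial.mem_vars_iff_mem_support _).mpr ⟨_, MvPolynomial.mem_support_iff.mpr h, by simp⟩

/-- Weight dividing: if ρ_d(A) ⊆ A for all d ≥ 1 and some element of A has nonzero coefficient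
of the single-variable monomial x_{g,m,0} for some m ≥ 1, then some element of A has nonzero
coefficient of x_{g,1,0} and zero coefficient of x_{g,m',0} for every m' > 1. -/
theorem weight_dividing (A : AddSubgroup Rz)
    (hρ : ∀ d : ℕ, 1 ≤ d → ∀ a ∈ A, ρz d a ∈ A)
    (g m : ℕ) (hm : 1 ≤ m)
    (hex : ∃ a ∈ A,
      MvPolynomial.coeff (Finsupp.single (⟨(g, m, 0), hm, mul_zero _⟩ : CurveIdx) 1) a ≠ 0) :
    ∃ a ∈ A,
      MvPolynomial.coeff (Finsupp.single (⟨(g, 1, 0), le_refl 1, mul_zero _⟩ : CurveIdx) 1) a ≠ 0 ∧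
      ∀ m' : ℕ, (hm' : 1 < m') →
        MvPolynomial.coeff
          (Finsupp.single (⟨(g, m', 0), le_of_lt hm', mul_zero _⟩ : CurveIdx) 1) a = 0 := by
  obtain ⟨a, ha, hne⟩ := hex
  obtain ⟨d, ⟨hd, hda⟩, hmax⟩ := (finite_setOf_coeff_single_ne_zero g a).exists_maximal
    ⟨m, ⟨hm, mul_zero _⟩, hne⟩
  refine ⟨ρz d a, hρ d hd.1 a ha, ?_, fun m' hm' => ?_⟩
  · rw [coeff_single_ρz hd.1 g 1 _ (by simpa using hd.1)]
    simpa only [mul_one] using hda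
  · have hlt : d < d * m' := lt_mul_of_one_lt_right hd.1 hm'
    have hdm : 1 ≤ d * m' ∧ (d * m' - 1) * 0 = 0 := ⟨hd.1.trans hlt.le, mul_zero _⟩
    rw [coeff_single_ρz hd.1 g m' _ hdm]
    by_contra hc
    exact hlt.not_ge (hmax ⟨hdm, hc⟩ hlt.le)
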